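/- arXiv:math/0601017 — 2 statements merged into one kernel-verified Lean document; each statement's English description precedes it below -/
import Mathlib

section
/- A positive integer n divisible by 3 and having exactly three distinct prime divisors is a primitive covering number if and only if n = 2 · 3^{(p−1)/2} · p for some prime p > 3. -/
/-- A positive integer `n` is a *covering number* if there is a finite system of
residue classes `aᵢ (mod mᵢ)` covering all of `ℤ`, whose moduli `mᵢ` are distinct,
all greater than `1`, and all divide `n`. -/
def IsCoveringNumber (n : ℕ) : Prop :=
  ∃ (k : ℕ) (a : Fin k → ℤ) (m : Fin k → ℕ),
    Function.Injective m ∧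
    (∀ i, 1 < m i) ∧ (∀ i, m i ∣ n) ∧
    (∀ x : ℤ, ∃ i, (m i : ℤ) ∣ x - a i)

/-- A covering number is *primitive* if none of its proper divisors is a covering number. -/
def IsPrimitiveCoveringNumber (n : ℕ) : Prop :=
  IsCoveringNumber n ∧ ∀ d : ℕ, d ∣ n → d ≠ n → ¬ IsCoveringNumber d

/-- The residue classes `a d (mod d)`, for `d` running over the divisors of `n` greater than `1`,
cover the integer `x`. -/
def CoversAt (n : ℕ) (a : ℕ → ℤ) (x : ℤ) : Prop :=
  ∃ d : ℕ, d ∣ n ∧ 1 < d ∧ (d : ℤ) ∣ x - a d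

theorem isCoveringNumber_iff {n : ℕ} (hn : 0 < n) :
    IsCoveringNumber n ↔ ∃ a : ℕ → ℤ, ∀ x, CoversAt n a x := by
  constructor
  · rintro ⟨k, a, m, hm, h1, hd, hc⟩
    refine ⟨Function.extend m a 0, fun x => ?_⟩
    obtain ⟨i, hi⟩ := hc x
    exact ⟨m i, hd i, h1 i, by rwa [hm.extend_apply]⟩
  · rintro ⟨a, ha⟩
    let e := (n.divisors.erase 1).equivFin.symm
    have he : ∀ i, (e i : ℕ) ≠ 1 ∧ (e i : ℕ) ∣ n := fun i => by
      have := (e i).2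
      simp only [Finset.mem_erase, Nat.mem_divisors] at this
      exact ⟨this.1, this.2.1⟩
    refine ⟨_, fun i => a (e i), fun i => (e i : ℕ),
      Subtype.val_injective.comp e.injective, fun i => ?_, fun i => (he i).2, fun x => ?_⟩
    · have := Nat.pos_of_dvd_of_pos (he i).2 hn
      exact lt_of_le_of_ne this (he i).1.symm
    · obtain ⟨d, hd, h1, hx⟩ := ha x
      refine ⟨e.symm ⟨d, ?_⟩, by simpa using hx⟩
      simp only [Finset.mem_erase, Nat.mem_divisors]
      exact ⟨by omega, hd, hn.ne'⟩

theorem IsCoveringNumber.of_dvd {d n : ℕ} (h : IsCoveringNumber d) (hd : d ∣ n) :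
    IsCoveringNumber n := by
  obtain ⟨k, a, m, hm, h1, hdv, hc⟩ := h
  exact ⟨k, a, m, hm, h1, fun i => (hdv i).trans hd, hc⟩

theorem card_filter_range_dvd_le {M m e : ℕ} (he : 0 < e) (hem : e ∣ m) (hc : e.Coprime M)
    (y : ℤ) :
    ((Finset.range m).filter (fun t : ℕ => (e : ℤ) ∣ y + M * t)).card ≤ m / e := by
  by_cases hne : ((Finset.range m).filter (fun t : ℕ => (e : ℤ) ∣ y + M * t)).Nonempty
  · obtain ⟨t₀, ht₀⟩ := hne
    have h0 := (Finset.mem_filter.1 ht₀).2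
    have hcount : m.count (· ≡ t₀ [MOD e]) = m / e := by
      rw [Nat.count_modEq_card _ he, Nat.mod_eq_zero_of_dvd hem]
      simp
    rw [← hcount, Nat.count_eq_card_filter_range]
    refine Finset.card_le_card fun t ht => ?_
    simp only [Finset.mem_filter] at ht ⊢
    refine ⟨ht.1, ?_⟩
    have h2 : (e : ℤ) ∣ (M : ℤ) * ((t₀ : ℤ) - t) := by
      have := dvd_sub h0 ht.2
      rwa [show y + M * t₀ - (y + M * t) = (M : ℤ) * ((t₀ : ℤ) - t) by ring] at this
    exact Nat.modEq_iff_dvd.2 (Int.dvd_of_dvd_mul_right_of_gcd_one h2 hc)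
  · rw [Finset.not_nonempty_iff_eq_empty.1 hne]
    simp

theorem sum_div_divisors_erase_one {m : ℕ} (hm : 0 < m) :
    ∑ e ∈ m.divisors.erase 1, m / e = ∑ e ∈ m.properDivisors, e := by
  have h1 := Nat.sum_div_divisors m (fun d => d)
  rw [Nat.sum_divisors_eq_sum_properDivisors_add_self,
    ← Finset.add_sum_erase _ _ (Nat.one_mem_divisors.2 hm.ne')] at h1
  simp only [Nat.div_one] at h1
  omega

/-- Counting along the fibre `x₀ + M ℤ` above a point missed by all moduli dividing `M`. -/
theorem le_sum_of_not_coversAt {M m : ℕ} (hM : 0 < M) (hm : 0 < m) (hc : M.Coprime m)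
    {a : ℕ → ℤ} (ha : ∀ x, CoversAt (M * m) a x) {x₀ : ℤ} (hx₀ : ¬ CoversAt M a x₀) :
    m ≤ ∑ d ∈ M.divisors, ∑ e ∈ m.divisors.erase 1,
      if (d : ℤ) ∣ x₀ - a (d * e) then m / e else 0 := by
  have hsub : Finset.range m ⊆ M.divisors.biUnion fun d => (m.divisors.erase 1).biUnion fun e =>
      (Finset.range m).filter (fun t : ℕ => ((d * e : ℕ) : ℤ) ∣ x₀ + M * t - a (d * e)) := by
    intro t ht
    obtain ⟨D, hD, h1, hx⟩ := ha (x₀ + M * t)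
    obtain ⟨d, e, hd, he, rfl⟩ := (Nat.dvd_mul).1 hD
    simp only [Finset.mem_biUnion, Finset.mem_filter, Finset.mem_erase, Nat.mem_divisors]
    refine ⟨d, ⟨hd, hM.ne'⟩, e, ⟨?_, he, hm.ne'⟩, ht, hx⟩
    rintro rfl
    rw [mul_one] at h1 hx
    refine hx₀ ⟨d, hd, h1, ?_⟩
    have h2 : (d : ℤ) ∣ (M : ℤ) * t := (Int.natCast_dvd_natCast.2 hd).mul_right _
    have := dvd_sub hx h2
    rwa [show x₀ + M * t - a d - M * t = x₀ - a d by ring] at this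
  have hcard := Finset.card_le_card hsub
  rw [Finset.card_range] at hcard
  refine hcard.trans (Finset.card_biUnion_le.trans (Finset.sum_le_sum fun d hd =>
    Finset.card_biUnion_le.trans (Finset.sum_le_sum fun e he => ?_)))
  simp only [Finset.mem_erase, Nat.mem_divisors] at hd he
  split_ifs with hdv
  · refine le_trans (Finset.card_le_card ?_) (card_filter_range_dvd_le
      (Nat.pos_of_dvd_of_pos he.2.1 hm) he.2.1
      (Nat.Coprime.coprime_dvd_left he.2.1 hc.symm) (x₀ - a (d * e)))
    intro t ht
    simp only [Finset.mem_filter] at ht ⊢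
    refine ⟨ht.1, ?_⟩
    have h2 : (e : ℤ) ∣ ((d * e : ℕ) : ℤ) := by
      push_cast
      exact dvd_mul_left _ _
    have := h2.trans ht.2
    rwa [show x₀ + M * t - a (d * e) = x₀ - a (d * e) + M * t by ring] at this
  · rw [Nat.le_zero, Finset.card_eq_zero, Finset.filter_eq_empty_iff]
    intro t _ hx
    apply hdv
    have h2 : (d : ℤ) ∣ ((d * e : ℕ) : ℤ) := by
      push_cast
      exact dvd_mul_right _ _
    have h3 : (d : ℤ) ∣ (M : ℤ) * t := (Int.natCast_dvd_natCast.2 hd.1).mul_right _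
    have := dvd_sub (h2.trans hx) h3
    rwa [show x₀ + M * t - a (d * e) - M * t = x₀ - a (d * e) by ring] at this

theorem not_isCoveringNumber_mul {M m : ℕ} (hM : 0 < M) (hm : 0 < m) (hc : M.Coprime m)
    (hMn : ¬ IsCoveringNumber M)
    (hlt : M.divisors.card * ∑ e ∈ m.properDivisors, e < m) :
    ¬ IsCoveringNumber (M * m) := by
  intro h
  obtain ⟨a, ha⟩ := (isCoveringNumber_iff (Nat.mul_pos hM hm)).1 h
  have : ∃ x₀, ¬ CoversAt M a x₀ := by
    by_contra! hcov
    exact hMn ((isCoveringNumber_iff hM).2 ⟨a, hcov⟩)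
  obtain ⟨x₀, hx₀⟩ := this
  refine absurd (le_sum_of_not_coversAt hM hm hc ha hx₀) (not_le.2 (lt_of_le_of_lt ?_ hlt))
  rw [← sum_div_divisors_erase_one hm, ← smul_eq_mul, ← Finset.sum_const]
  refine Finset.sum_le_sum fun d _ => Finset.sum_le_sum fun e _ => ?_
  split_ifs
  · exact le_rfl
  · exact Nat.zero_le _

theorem not_isCoveringNumber_mul_of_sum_properDivisors {M m : ℕ} (hM : 0 < M) (hm : 0 < m)
    (hc : M.Coprime m) (hMs : 2 * ∑ d ∈ M.properDivisors, d ≤ M)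
    (hms : 2 * ∑ e ∈ m.properDivisors, e < m) :
    ¬ IsCoveringNumber (M * m) := by
  classical
  intro h
  obtain ⟨a, ha⟩ := (isCoveringNumber_iff (Nat.mul_pos hM hm)).1 h
  have hcount : ∀ d ∈ M.divisors, ∀ z : ℤ,
      ((Finset.range M).filter (fun s : ℕ => (d : ℤ) ∣ (s : ℤ) - z)).card ≤ M / d := by
    intro d hd z
    have hd := (Nat.mem_divisors.1 hd).1
    have := card_filter_range_dvd_le (M := 1) (Nat.pos_of_dvd_of_pos hd hM) hd
      (Nat.coprime_one_right d) (-z)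
    convert this using 5
    push_cast
    ring
  set U := (Finset.range M).filter (fun s : ℕ => ¬ CoversAt M a s) with hU
  set S := ∑ e ∈ m.properDivisors, e with hS
  set H := ∑ d ∈ M.properDivisors, d with hH
  have hUcard : M ≤ U.card + H := by
    have h1 : (Finset.range M).filter (fun s : ℕ => CoversAt M a s) ⊆
        (M.divisors.erase 1).biUnion fun d =>
          (Finset.range M).filter (fun s : ℕ => (d : ℤ) ∣ (s : ℤ) - a d) := by
      intro s hs
      obtain ⟨hs, d, hd, hd1, hx⟩ := Finset.mem_filter.1 hs
      simp only [Finset.mem_biUnion, Finset.mem_filter, Finset.mem_erase, Nat.mem_divisors]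
      exact ⟨d, ⟨by omega, hd, hM.ne'⟩, hs, hx⟩
    have h2 : ((Finset.range M).filter (fun s : ℕ => CoversAt M a s)).card ≤ H := by
      rw [hH, ← sum_div_divisors_erase_one hM]
      exact (Finset.card_le_card h1).trans (Finset.card_biUnion_le.trans
        (Finset.sum_le_sum fun d hd => hcount d (Finset.mem_of_mem_erase hd) _))
    have h3 := Finset.card_filter_add_card_filter_not (s := Finset.range M)
      (fun s : ℕ => CoversAt M a s)
    rw [Finset.card_range] at h3
    change _ + U.card = M at h3
    omega
  have key : U.card * m ≤ S * (U.card + H) := by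
    calc U.card * m
        = ∑ s ∈ U, m := by rw [Finset.sum_const, smul_eq_mul]
      _ ≤ ∑ s ∈ U, ∑ d ∈ M.divisors, ∑ e ∈ m.divisors.erase 1,
          (if (d : ℤ) ∣ (s : ℤ) - a (d * e) then m / e else 0) :=
        Finset.sum_le_sum fun s hs =>
          le_sum_of_not_coversAt hM hm hc ha (Finset.mem_filter.1 hs).2
      _ = ∑ d ∈ M.divisors, ∑ e ∈ m.divisors.erase 1, ∑ s ∈ U,
          (if (d : ℤ) ∣ (s : ℤ) - a (d * e) then m / e else 0) := by
        rw [Finset.sum_comm]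
        exact Finset.sum_congr rfl fun d _ => Finset.sum_comm
      _ ≤ ∑ d ∈ M.divisors, ∑ e ∈ m.divisors.erase 1,
          (if d = 1 then U.card else M / d) * (m / e) := by
        refine Finset.sum_le_sum fun d hd => Finset.sum_le_sum fun e _ => ?_
        rw [← Finset.sum_filter, Finset.sum_const, smul_eq_mul]
        refine Nat.mul_le_mul_right _ ?_
        split_ifs
        · exact Finset.card_filter_le _ _
        · refine le_trans (Finset.card_le_card ?_) (hcount d hd (a (d * e)))
          exact Finset.filter_subset_filter _ (Finset.filter_subset _ _)
      _ = S * (U.card + H) := by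
        rw [← Finset.sum_mul_sum, sum_div_divisors_erase_one hm, mul_comm, hH,
          ← sum_div_divisors_erase_one hM,
          ← Finset.add_sum_erase _ _ (Nat.one_mem_divisors.2 hM.ne')]
        congr 2
        refine Finset.sum_congr rfl fun d hd => ?_
        rw [if_neg (Finset.ne_of_mem_erase hd)]
  have hUpos : 0 < U.card := by omega
  have hHU : H ≤ U.card := by omega
  nlinarith [Nat.mul_le_mul_left S hHU]

theorem sum_properDivisors_prime_pow_mul {p : ℕ} (hp : p.Prime) (c : ℕ) :
    (∑ e ∈ (p ^ c).properDivisors, e) * (p - 1) + 1 = p ^ c := by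
  rw [Nat.sum_properDivisors_prime_nsmul hp (f := fun e => e)]
  have := geom_sum_mul_add (p - 1) c
  rwa [Nat.sub_add_cancel hp.one_le] at this

theorem not_isCoveringNumber_mul_prime_pow {M p : ℕ} (hM : 0 < M) (hp : p.Prime) (hpM : ¬ p ∣ M)
    (hMn : ¬ IsCoveringNumber M) (hlt : M.divisors.card < p) (c : ℕ) :
    ¬ IsCoveringNumber (M * p ^ c) := by
  refine not_isCoveringNumber_mul hM (pow_pos hp.pos c)
    (((Nat.Prime.coprime_iff_not_dvd hp).2 hpM).symm.pow_right c) hMn ?_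
  have h1 := sum_properDivisors_prime_pow_mul hp c
  have h2 : M.divisors.card ≤ p - 1 := by omega
  have := Nat.mul_le_mul_right (∑ e ∈ (p ^ c).properDivisors, e) h2
  rw [mul_comm (p - 1)] at this
  omega

theorem not_isCoveringNumber_two : ¬ IsCoveringNumber 2 := by
  rw [isCoveringNumber_iff two_pos]
  rintro ⟨a, ha⟩
  obtain ⟨d, hd, h1, hx⟩ := ha (a 2 + 1)
  obtain rfl : d = 2 := le_antisymm (Nat.le_of_dvd two_pos hd) h1
  simp at hx

theorem not_isCoveringNumber_two_mul_three_pow (b : ℕ) : ¬ IsCoveringNumber (2 * 3 ^ b) :=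
  not_isCoveringNumber_mul_prime_pow two_pos Nat.prime_three (by norm_num)
    not_isCoveringNumber_two (by decide) b

theorem card_divisors_two_mul_three_pow (b : ℕ) : (2 * 3 ^ b).divisors.card = 2 * (b + 1) := by
  rw [Nat.Coprime.card_divisors_mul (Nat.Coprime.pow_right b (by norm_num)),
    Nat.divisors_prime_pow Nat.prime_three, Finset.card_map, Finset.card_range]
  rfl

theorem not_dvd_two_mul_three_pow {p : ℕ} (hp : p.Prime) (h3 : 3 < p) (b : ℕ) :
    ¬ p ∣ 2 * 3 ^ b := by
  intro h
  rcases hp.dvd_mul.1 h with h | h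
  · have := Nat.le_of_dvd two_pos h
    omega
  · have := Nat.le_of_dvd three_pos (hp.dvd_of_dvd_pow h)
    omega

theorem not_isCoveringNumber_two_mul_three_pow_mul {p : ℕ} (hp : p.Prime) (h3 : 3 < p) {b : ℕ}
    (hb : 2 * (b + 1) < p) (c : ℕ) : ¬ IsCoveringNumber (2 * 3 ^ b * p ^ c) :=
  not_isCoveringNumber_mul_prime_pow (by positivity) hp (not_dvd_two_mul_three_pow hp h3 b)
    (not_isCoveringNumber_two_mul_three_pow b) (by rwa [card_divisors_two_mul_three_pow]) c

theorem not_isCoveringNumber_three_pow_mul {m : ℕ} (hm : 0 < m) (h3 : ¬ 3 ∣ m)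
    (hms : 2 * ∑ e ∈ m.properDivisors, e < m) (b : ℕ) : ¬ IsCoveringNumber (3 ^ b * m) := by
  refine not_isCoveringNumber_mul_of_sum_properDivisors (by positivity) hm
    (((Nat.Prime.coprime_iff_not_dvd Nat.prime_three).2 h3).pow_left b) ?_ hms
  have := sum_properDivisors_prime_pow_mul Nat.prime_three b
  omega

theorem two_mul_sum_properDivisors_lt {q r : ℕ} (hq : q.Prime) (hr : r.Prime) (hq5 : 5 ≤ q)
    (hr7 : 7 ≤ r) (hqr : q ≠ r) (c d : ℕ) :
    2 * ∑ e ∈ (q ^ c * r ^ d).properDivisors, e < q ^ c * r ^ d := by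
  have hcop : (q ^ c).Coprime (r ^ d) := ((Nat.coprime_primes hq hr).2 hqr).pow c d
  have h1 := hcop.sum_divisors_mul
  simp only [Nat.sum_divisors_eq_sum_properDivisors_add_self] at h1
  have hQ := sum_properDivisors_prime_pow_mul hq c
  have hR := sum_properDivisors_prime_pow_mul hr d
  set s := ∑ e ∈ (q ^ c).properDivisors, e
  set t := ∑ e ∈ (r ^ d).properDivisors, e
  have hs : 4 * s < q ^ c := by
    have := Nat.mul_le_mul_left s (show 4 ≤ q - 1 by omega)
    omega
  have ht : 6 * t < r ^ d := by
    have := Nat.mul_le_mul_left t (show 6 ≤ r - 1 by omega)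
    omega
  nlinarith [Nat.mul_le_mul hs.le ht.le, Nat.mul_le_mul_left (r ^ d) hs.le,
    Nat.mul_le_mul_left (q ^ c) ht.le, Nat.mul_pos (pow_pos hq.pos c) (pow_pos hr.pos d)]

/-- If the moduli dividing `M` can cover everything outside one class modulo `M`, then `p` further
moduli `d * p` with `d ∣ M` finish the covering. -/
theorem isCoveringNumber_mul_prime {M p : ℕ} (hM : 0 < M) (hp : p.Prime) (hpM : ¬ p ∣ M)
    (hcard : p ≤ M.divisors.card) {b : ℕ → ℤ} {x₀ : ℤ}
    (hb : ∀ x, CoversAt M b x ∨ (M : ℤ) ∣ x - x₀) : IsCoveringNumber (M * p) := by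
  classical
  rw [isCoveringNumber_iff (Nat.mul_pos hM hp.pos)]
  obtain ⟨f⟩ : Nonempty (Fin p ↪ M.divisors) :=
    Function.Embedding.nonempty_of_card_le (by simpa using hcard)
  have hcrt : ∀ i : Fin p, ∃ z : ℤ, ((f i : ℕ) : ℤ) ∣ z - x₀ ∧ (p : ℤ) ∣ z - i := by
    intro i
    have hcop : IsCoprime ((f i : ℕ) : ℤ) (p : ℤ) := by
      rw [Nat.isCoprime_iff_coprime]
      exact (((Nat.Prime.coprime_iff_not_dvd hp).2 hpM).symm).coprime_dvd_left
        (Nat.mem_divisors.1 (f i).2).1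
    obtain ⟨u, v, huv⟩ := hcop
    refine ⟨x₀ * (v * p) + i * (u * (f i : ℕ)), ⟨u * (i - x₀), ?_⟩, ⟨v * (x₀ - i), ?_⟩⟩
    · linear_combination x₀ * huv
    · linear_combination (i : ℤ) * huv
  choose z hz1 hz2 using hcrt
  have hinj : Function.Injective fun i : Fin p => (f i : ℕ) * p := fun i j hij =>
    f.injective (Subtype.ext (Nat.eq_of_mul_eq_mul_right hp.pos hij))
  refine ⟨fun d => if p ∣ d then Function.extend (fun i : Fin p => (f i : ℕ) * p) z 0 d else b d,
    fun x => ?_⟩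
  rcases hb x with ⟨d, hd, h1, hx⟩ | hx
  · refine ⟨d, hd.mul_right p, h1, ?_⟩
    beta_reduce
    rwa [if_neg fun h => hpM (h.trans hd)]
  · have hp0 : (0 : ℤ) < p := by exact_mod_cast hp.pos
    let i : Fin p := ⟨(x % p).toNat, by
      have := Int.emod_lt_of_pos x hp0
      have := Int.emod_nonneg x hp0.ne'
      omega⟩
    have hi : ((i : ℕ) : ℤ) = x % p := Int.toNat_of_nonneg (Int.emod_nonneg x hp0.ne')
    have hfi := (Nat.mem_divisors.1 (f i).2).1
    have hfpos := Nat.pos_of_dvd_of_pos hfi hM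
    refine ⟨(f i : ℕ) * p, Nat.mul_dvd_mul_right hfi p,
      lt_of_lt_of_le hp.one_lt (Nat.le_mul_of_pos_left p hfpos), ?_⟩
    beta_reduce
    rw [if_pos (dvd_mul_left _ _), hinj.extend_apply]
    push_cast
    refine IsCoprime.mul_dvd ?_ ?_ ?_
    · rw [Nat.isCoprime_iff_coprime]
      exact (((Nat.Prime.coprime_iff_not_dvd hp).2 hpM).symm).coprime_dvd_left hfi
    · have := dvd_sub ((Int.natCast_dvd_natCast.2 hfi).trans hx) (hz1 i)
      rwa [sub_sub_sub_cancel_right] at this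
    · have h1 : (p : ℤ) ∣ x - i := by
        rw [hi]
        exact Int.dvd_self_sub_emod
      have := dvd_sub h1 (hz2 i)
      rwa [sub_sub_sub_cancel_right] at this

theorem exists_coversAt_two_mul_three_pow (k : ℕ) :
    ∃ b : ℕ → ℤ, ∀ x, CoversAt (2 * 3 ^ k) b x ∨ ((2 * 3 ^ k : ℕ) : ℤ) ∣ x - (-1) := by
  induction k with
  | zero =>
    refine ⟨fun _ => 0, fun x => ?_⟩
    by_cases hx : (2 : ℤ) ∣ x
    · exact Or.inl ⟨2, by norm_num, by norm_num, by simpa using hx⟩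
    · right
      norm_num
      omega
  | succ k ih =>
    obtain ⟨b, hb⟩ := ih
    have hpos : 0 < 3 ^ k := by positivity
    have hpow : 3 ^ (k + 1) = 3 * 3 ^ k := by ring
    refine ⟨fun d => if d = 3 ^ (k + 1) then 3 ^ k - 1 else
      if d = 2 * 3 ^ (k + 1) then 2 * 3 ^ k - 1 else b d, fun x => ?_⟩
    rcases hb x with ⟨d, hd, h1, hx⟩ | ⟨y, hy⟩
    · left
      have hle := Nat.le_of_dvd (by positivity) hd
      refine ⟨d, hd.trans ⟨3, by ring⟩, h1, ?_⟩
      beta_reduce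
      rwa [if_neg (by omega), if_neg (by omega)]
    · push_cast at hy
      have hy3 : y % 3 = 0 ∨ y % 3 = 1 ∨ y % 3 = 2 := by omega
      rcases hy3 with h | h | h
      · obtain ⟨w, rfl⟩ : (3 : ℤ) ∣ y := by omega
        right
        refine ⟨w, ?_⟩
        push_cast
        rw [hy]
        ring
      · obtain ⟨w, hw⟩ : (3 : ℤ) ∣ y - 1 := by omega
        left
        refine ⟨2 * 3 ^ (k + 1), dvd_rfl, by omega, ?_⟩
        beta_reduce
        rw [if_neg (by omega), if_pos rfl]
        refine ⟨w, ?_⟩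
        push_cast
        linear_combination hy + 2 * 3 ^ k * hw
      · obtain ⟨w, hw⟩ : (3 : ℤ) ∣ 2 * y - 1 := by omega
        left
        refine ⟨3 ^ (k + 1), dvd_mul_left _ _, by omega, ?_⟩
        beta_reduce
        rw [if_pos rfl]
        refine ⟨w, ?_⟩
        push_cast
        linear_combination hy + 3 ^ k * hw

theorem isCoveringNumber_two_mul_three_pow_mul {p k : ℕ} (hp : p.Prime) (h3 : 3 < p)
    (hk : p ≤ 2 * (k + 1)) : IsCoveringNumber (2 * 3 ^ k * p) := by
  obtain ⟨b, hb⟩ := exists_coversAt_two_mul_three_pow k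
  exact isCoveringNumber_mul_prime (by positivity) hp (not_dvd_two_mul_three_pow hp h3 k)
    (by rwa [card_divisors_two_mul_three_pow]) hb

theorem isCoveringNumber_twelve : IsCoveringNumber 12 := by
  rw [isCoveringNumber_iff (by norm_num)]
  refine ⟨fun d => if d = 4 then 1 else if d = 6 then 5 else if d = 12 then 7 else 0,
    fun x => ?_⟩
  have h : (2 : ℤ) ∣ x ∨ (3 : ℤ) ∣ x ∨ (4 : ℤ) ∣ x - 1 ∨ (6 : ℤ) ∣ x - 5 ∨ (12 : ℤ) ∣ x - 7 := by
    have h0 := Int.emod_nonneg x (show (12 : ℤ) ≠ 0 by norm_num)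
    have h1 := Int.emod_lt_of_pos x (show (0 : ℤ) < 12 by norm_num)
    interval_cases hx : x % 12 <;> omega
  rcases h with h | h | h | h | h
  · exact ⟨2, by norm_num, by norm_num, by simpa using h⟩
  · exact ⟨3, by norm_num, by norm_num, by simpa using h⟩
  · exact ⟨4, by norm_num, by norm_num, by simpa using h⟩
  · exact ⟨6, by norm_num, by norm_num, by simpa using h⟩
  · exact ⟨12, by norm_num, by norm_num, by simpa using h⟩

theorem isPrimitiveCoveringNumber_two_mul_three_pow_mul {p : ℕ} (hp : p.Prime) (h3 : 3 < p) :
    IsPrimitiveCoveringNumber (2 * 3 ^ ((p - 1) / 2) * p) := by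
  have hodd := hp.eq_two_or_odd
  obtain ⟨k, hk⟩ : ∃ k, (p - 1) / 2 = k + 1 := ⟨(p - 1) / 2 - 1, by omega⟩
  rw [hk]
  refine ⟨isCoveringNumber_two_mul_three_pow_mul hp h3 (by omega), fun d hd hne hcov => ?_⟩
  obtain ⟨w, hw⟩ := hd
  have hw1 : w ≠ 1 := by
    rintro rfl
    exact hne (by rw [hw, mul_one])
  obtain ⟨l, hl, v, rfl⟩ := Nat.exists_prime_and_dvd hw1
  have hln : l ∣ 2 * 3 ^ (k + 1) * p := ⟨d * v, by rw [hw]; ring⟩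
  have hdvd : ∀ N, 2 * 3 ^ (k + 1) * p = l * N → IsCoveringNumber N := fun N hN =>
    hcov.of_dvd ⟨v, Nat.eq_of_mul_eq_mul_left hl.pos (by rw [← hN, hw]; ring)⟩
  rcases hl.dvd_mul.1 hln with h | h
  · rcases hl.dvd_mul.1 h with h | h
    · obtain rfl := (Nat.prime_dvd_prime_iff_eq hl Nat.prime_two).1 h
      refine not_isCoveringNumber_three_pow_mul hp.pos (fun h => ?_) ?_ (k + 1)
        (hdvd (3 ^ (k + 1) * p) (by ring))
      · have := (Nat.prime_dvd_prime_iff_eq Nat.prime_three hp).1 h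
        omega
      · rw [hp.sum_properDivisors (f := fun e => e)]
        omega
    · obtain rfl := (Nat.prime_dvd_prime_iff_eq hl Nat.prime_three).1 (hl.dvd_of_dvd_pow h)
      refine not_isCoveringNumber_two_mul_three_pow_mul hp h3 (b := k) (by omega) 1
        (hdvd _ (by ring))
  · obtain rfl := (Nat.prime_dvd_prime_iff_eq hl hp).1 h
    exact not_isCoveringNumber_two_mul_three_pow (k + 1) (hdvd _ (by ring))

theorem exists_eq_three_pow_mul {n : ℕ} (hn : 0 < n) (h3 : 3 ∣ n)
    (h : n.primeFactors.card = 3) :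
    ∃ q r b c d : ℕ, q.Prime ∧ r.Prime ∧ q ≠ 3 ∧ r ≠ 3 ∧ q < r ∧ 0 < b ∧ 0 < c ∧ 0 < d ∧
      n = 3 ^ b * (q ^ c * r ^ d) := by
  have h3m : 3 ∈ n.primeFactors := Nat.mem_primeFactors.2 ⟨Nat.prime_three, h3, hn.ne'⟩
  have hprod : ∏ p ∈ n.primeFactors, p ^ n.factorization p = n :=
    Nat.prod_factorization_pow_eq_self hn.ne'
  have hcard : (n.primeFactors.erase 3).card = 2 := by
    rw [Finset.card_erase_of_mem h3m, h]
  have hpos : ∀ p ∈ n.primeFactors, 0 < n.factorization p := fun p hp =>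
    (Nat.prime_of_mem_primeFactors hp).factorization_pos_of_dvd hn.ne'
      (Nat.dvd_of_mem_primeFactors hp)
  rw [← Finset.mul_prod_erase _ _ h3m] at hprod
  obtain ⟨q, r, hqr, hS⟩ := Finset.card_eq_two.1 hcard
  have hq : q ∈ n.primeFactors.erase 3 := by simp [hS]
  have hr : r ∈ n.primeFactors.erase 3 := by simp [hS]
  rw [hS, Finset.prod_pair hqr] at hprod
  rw [Finset.mem_erase] at hq hr
  rcases lt_or_gt_of_ne hqr with hlt | hlt
  · exact ⟨q, r, _, _, _, Nat.prime_of_mem_primeFactors hq.2, Nat.prime_of_mem_primeFactors hr.2,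
      hq.1, hr.1, hlt, hpos 3 h3m, hpos q hq.2, hpos r hr.2, hprod.symm⟩
  · refine ⟨r, q, _, _, _, Nat.prime_of_mem_primeFactors hr.2, Nat.prime_of_mem_primeFactors hq.2,
      hr.1, hq.1, hlt, hpos 3 h3m, hpos r hr.2, hpos q hq.2, ?_⟩
    rw [mul_comm (r ^ _)]
    exact hprod.symm

theorem stmt7 (n : ℕ) (hn : 0 < n) (h3 : 3 ∣ n) (h : n.primeFactors.card = 3) :
    IsPrimitiveCoveringNumber n ↔
      ∃ p : ℕ, p.Prime ∧ 3 < p ∧ n = 2 * 3 ^ ((p - 1) / 2) * p := by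
  constructor
  · rintro ⟨hcov, hprim⟩
    obtain ⟨q, r, b, c, d, hq, hr, hq3, hr3, hqr, hb, hc, hd, hnN⟩ :=
      exists_eq_three_pow_mul hn h3 h
    have hq2 := hq.two_le
    by_cases hq_two : q = 2
    · subst hq_two
      have hr5 : 3 < r := by omega
      have hrn : r ∣ n := by
        rw [hnN]
        exact dvd_mul_of_dvd_right (dvd_mul_of_dvd_right (dvd_pow_self r hd.ne') _) _
      have hc1 : c = 1 := by
        by_contra hc1
        have h12 : 12 ∣ n := by
          rw [hnN, ← mul_assoc]
          exact (Nat.mul_dvd_mul (pow_dvd_pow 3 hb)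
            (pow_dvd_pow 2 (show 2 ≤ c by omega))).mul_right _
        refine hprim 12 h12 ?_ isCoveringNumber_twelve
        rintro rfl
        exact not_dvd_two_mul_three_pow hr hr5 1 ((hr.dvd_mul.1
          (show r ∣ 2 * (2 * 3 ^ 1) from hrn)).elim (fun h => h.mul_right _) id)
      subst hc1
      refine ⟨r, hr, hr5, ?_⟩
      have hle : (r - 1) / 2 ≤ b := by
        by_contra! hlt
        refine not_isCoveringNumber_two_mul_three_pow_mul hr hr5 (b := b) (by omega) d ?_
        convert hcov using 1
        rw [hnN]
        ring
      have hdvd : 2 * 3 ^ ((r - 1) / 2) * r ∣ n := by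
        have : n = 2 * 3 ^ b * r ^ d := by
          rw [hnN]
          ring
        rw [this]
        exact Nat.mul_dvd_mul (Nat.mul_dvd_mul_left 2 (pow_dvd_pow 3 hle))
          (dvd_pow_self r hd.ne')
      by_contra hne
      exact hprim _ hdvd (Ne.symm hne)
        (isCoveringNumber_two_mul_three_pow_mul hr hr5 (by omega))
    · exfalso
      have hq4 : q ≠ 4 := by
        rintro rfl
        norm_num at hq
      have hr6 : r ≠ 6 := by
        rintro rfl
        norm_num at hr
      rw [hnN] at hcov
      refine not_isCoveringNumber_three_pow_mul
        (Nat.mul_pos (pow_pos hq.pos c) (pow_pos hr.pos d)) (fun h => ?_)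
        (two_mul_sum_properDivisors_lt hq hr (by omega) (by omega) hqr.ne c d) b hcov
      rcases Nat.prime_three.dvd_mul.1 h with h | h
      · exact hq3 ((Nat.prime_dvd_prime_iff_eq Nat.prime_three hq).1
          (Nat.prime_three.dvd_of_dvd_pow h)).symm
      · exact hr3 ((Nat.prime_dvd_prime_iff_eq Nat.prime_three hr).1
          (Nat.prime_three.dvd_of_dvd_pow h)).symm
  · rintro ⟨p, hp, hp3, rfl⟩
    exact isPrimitiveCoveringNumber_two_mul_three_pow_mul hp hp3
end

section
/- There are infinitely many positive integers n with the following property: n is a covering number, and for every cover of ℤ by residue classes whose moduli are distinct, all greater than 1, and all divide n, the set of moduli equals D_n = {d ≥ 2 : d divides n}. -/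
theorem IsCoveringNumber.of_fintype {ι : Type*} [Fintype ι] {n : ℕ} (a : ι → ℤ) (m : ι → ℕ)
    (hm : Function.Injective m) (h1 : ∀ i, 1 < m i) (hd : ∀ i, m i ∣ n)
    (hc : ∀ x : ℤ, ∃ i, (m i : ℤ) ∣ x - a i) : IsCoveringNumber n := by
  let e := Fintype.equivFin ι
  refine ⟨Fintype.card ι, a ∘ e.symm, m ∘ e.symm, hm.comp e.symm.injective,
    fun i => h1 _, fun i => hd _, fun x => ?_⟩
  obtain ⟨i, hi⟩ := hc x
  exact ⟨e i, by simpa using hi⟩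

theorem dvd_two_pow_mul_prime {p d s : ℕ} (hp : p.Prime) (hd : d ∣ 2 ^ s * p) :
    ∃ f ≤ s, d = 2 ^ f ∨ d = 2 ^ f * p := by
  obtain ⟨u, v, hu, hv, rfl⟩ := Nat.dvd_mul.1 hd
  obtain ⟨f, hf, rfl⟩ := (Nat.dvd_prime_pow Nat.prime_two).1 hu
  rcases (Nat.dvd_prime hp).1 hv with rfl | rfl
  · exact ⟨f, hf, Or.inl (mul_one _)⟩
  · exact ⟨f, hf, Or.inr rfl⟩

/-- An integer not divisible by `2 ^ s` is congruent to `2 ^ e` modulo `2 ^ (e + 1)` for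
some `e < s`. -/
theorem exists_two_pow_succ_dvd_sub {x : ℤ} {s : ℕ} (hx : ¬ (2 : ℤ) ^ s ∣ x) :
    ∃ e < s, (2 : ℤ) ^ (e + 1) ∣ x - 2 ^ e := by
  induction s with
  | zero => simp at hx
  | succ s ih =>
    by_cases h : (2 : ℤ) ^ s ∣ x
    · obtain ⟨c, rfl⟩ := h
      refine ⟨s, s.lt_succ_self, ?_⟩
      have hc : ¬ (2 : ℤ) ∣ c := fun h => hx (by rw [pow_succ]; exact mul_dvd_mul_left _ h)
      obtain ⟨t, ht⟩ : (2 : ℤ) ∣ c - 1 := by omega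
      exact ⟨t, by rw [pow_succ, mul_assoc, ← ht]; ring⟩
    · obtain ⟨e, he, h'⟩ := ih h
      exact ⟨e, he.trans s.lt_succ_self, h'⟩

theorem isCoveringNumber_two_pow_mul {p : ℕ} (hp : p.Prime) (h2 : p ≠ 2) :
    IsCoveringNumber (2 ^ (p - 1) * p) := by
  have hcop : Nat.Coprime 2 p := (Nat.coprime_primes Nat.prime_two hp).2 h2.symm
  have hndvd (f : ℕ) : ¬ p ∣ 2 ^ f := fun h =>
    h2 ((Nat.prime_dvd_prime_iff_eq hp Nat.prime_two).1 (hp.dvd_of_dvd_pow h))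
  have hfermat : (p : ℤ) ∣ 2 ^ (p - 1) - 1 := by
    have h : (2 : ℤ) ^ (p - 1) ≡ 1 [ZMOD p] :=
      Int.ModEq.pow_card_sub_one_eq_one hp (by exact_mod_cast Nat.isCoprime_iff_coprime.2 hcop)
    exact h.symm.dvd
  refine IsCoveringNumber.of_fintype (ι := Fin (p - 1) ⊕ Fin p)
    (Sum.elim (fun i => 2 ^ (i : ℕ)) fun i => 2 ^ (p - 1) * (i : ℕ))
    (Sum.elim (fun i => 2 ^ ((i : ℕ) + 1)) fun i => 2 ^ (i : ℕ) * p) ?_ ?_ ?_ ?_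
  · refine Function.Injective.sumElim ?_ ?_ ?_
    · intro i j h
      have := Nat.pow_right_injective le_rfl h
      exact Fin.ext (by simpa using this)
    · intro i j h
      have := Nat.pow_right_injective le_rfl (Nat.eq_of_mul_eq_mul_right hp.pos h)
      exact Fin.ext this
    · intro i j h
      exact hndvd _ (h ▸ Dvd.intro_left _ rfl)
  · rintro (i | i)
    · exact Nat.one_lt_two_pow (Nat.succ_ne_zero _)
    · exact hp.one_lt.trans_le (Nat.le_mul_of_pos_left _ (by positivity))
  · rintro (i | i)
    · exact (pow_dvd_pow 2 (by omega)).mul_right _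
    · exact mul_dvd_mul_right (pow_dvd_pow 2 (by omega)) _
  · intro x
    by_cases hx : (2 : ℤ) ^ (p - 1) ∣ x
    · have hp0 : (0 : ℤ) < p := by exact_mod_cast hp.pos
      have hr0 := Int.emod_nonneg x hp0.ne'
      have hrp := Int.emod_lt_of_pos x hp0
      have hr : (((x % p).toNat : ℕ) : ℤ) = x % p := Int.toNat_of_nonneg hr0
      refine ⟨Sum.inr ⟨(x % p).toNat, by omega⟩, ?_⟩
      simp only [Sum.elim_inr, Nat.cast_mul, Nat.cast_pow, Nat.cast_ofNat]
      refine IsCoprime.mul_dvd ?_ ?_ ?_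
      · exact_mod_cast (Nat.isCoprime_iff_coprime.2 hcop).pow_left
      · exact (pow_dvd_pow 2 (by omega)).trans (Int.dvd_sub hx (Dvd.intro _ rfl))
      · rw [hr]
        have h := dvd_sub (Int.dvd_self_sub_emod (x := x) (m := p)) (hfermat.mul_right (x % p))
        convert h using 1
        ring
    · obtain ⟨e, he, h⟩ := exists_two_pow_succ_dvd_sub hx
      exact ⟨Sum.inl ⟨e, he⟩, by simpa using h⟩

/-- If each `C e` is contained in a single class modulo `2 ^ e`, then every class modulo `2 ^ s`
contains an integer avoiding `C e` for all `s < e ≤ t`. -/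
theorem exists_congr_avoiding {C : ℕ → ℤ → Prop}
    (hC : ∀ e x y, C e x → C e y → (2 : ℤ) ^ e ∣ x - y) (x : ℤ) {s t : ℕ} (hst : s ≤ t) :
    ∃ y, (2 : ℤ) ^ s ∣ y - x ∧ ∀ e, s < e → e ≤ t → ∀ z, (2 : ℤ) ^ t ∣ z - y → ¬ C e z := by
  induction t, hst using Nat.le_induction with
  | base => exact ⟨x, by simp, fun e h1 h2 => by omega⟩
  | succ t hst ih =>
    obtain ⟨y, hyx, hy⟩ := ih
    have htt : (2 : ℤ) ^ t ∣ 2 ^ (t + 1) := pow_dvd_pow 2 t.le_succ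
    by_cases h : ∃ z, (2 : ℤ) ^ (t + 1) ∣ z - y ∧ C (t + 1) z
    · obtain ⟨w, hw, hCw⟩ := h
      refine ⟨y + 2 ^ t, ?_, ?_⟩
      · have := Int.dvd_add hyx (pow_dvd_pow (2 : ℤ) hst)
        convert this using 1
        ring
      · intro e hse het z hz hCz
        rcases het.lt_or_eq with het | rfl
        · refine hy e hse (by omega) z ?_ hCz
          have := Int.dvd_add (htt.trans hz) (dvd_refl ((2 : ℤ) ^ t))
          convert this using 1
          ring
        · have h1 := Int.dvd_sub (Int.dvd_sub (hC _ _ _ hCz hCw) hz) (dvd_neg.2 hw)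
          have h2 : (2 : ℤ) ^ (t + 1) ∣ 2 ^ t := by
            convert h1 using 1
            ring
          have := (pow_dvd_pow_iff (by norm_num) (by decide)).1 h2
          omega
    · refine ⟨y, hyx, fun e hse het z hz hCz => ?_⟩
      rcases het.lt_or_eq with het | rfl
      · exact hy e hse (by omega) z (htt.trans hz) hCz
      · exact h ⟨z, hz, hCz⟩

section Cover

variable {ι : Type*} {p : ℕ} {a : ι → ℤ} {m : ι → ℕ}

/-- In a cover with distinct moduli dividing `2 ^ (p - 1) * p`, a class modulo `2 ^ (p - 1)` that
avoids all power-of-two moduli meets a residue class of modulus `2 ^ f * p` for every `f < p`. -/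
theorem exists_modulus_two_pow_mul (hp : p.Prime) (h2 : p ≠ 2)
    (hm : Function.Injective m) (hd : ∀ i, m i ∣ 2 ^ (p - 1) * p)
    (hc : ∀ x : ℤ, ∃ i, (m i : ℤ) ∣ x - a i) {x : ℤ}
    (hx : ∀ z, (2 : ℤ) ^ (p - 1) ∣ z - x → ∀ i, ∀ e ≤ p - 1, m i = 2 ^ e →
      ¬ (2 : ℤ) ^ e ∣ z - a i) {f : ℕ} (hf : f < p) :
    ∃ i, m i = 2 ^ f * p ∧ (2 : ℤ) ^ f ∣ x - a i := by
  have key (r : Fin p) : ∃ g : Fin p, ∃ i, m i = 2 ^ (g : ℕ) * p ∧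
      (m i : ℤ) ∣ x + 2 ^ (p - 1) * (r : ℕ) - a i := by
    obtain ⟨i, hi⟩ := hc (x + 2 ^ (p - 1) * (r : ℕ))
    obtain ⟨g, hg, h | h⟩ := dvd_two_pow_mul_prime hp (hd i)
    · refine absurd ?_ (hx (x + 2 ^ (p - 1) * (r : ℕ)) (by simp) i g hg h)
      rw [h] at hi
      exact_mod_cast hi
    · exact ⟨⟨g, by have := hp.pos; omega⟩, i, h, hi⟩
  choose g i hmi hi using key
  have hg : Function.Injective g := by
    intro r r' h
    have hii : i r = i r' := hm (by rw [hmi, hmi, h])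
    have h1 := hi r
    rw [hii] at h1
    have h3 := Int.dvd_sub h1 (hi r')
    have hpm : (p : ℤ) ∣ (m (i r') : ℤ) := by
      rw [hmi]
      exact Int.natCast_dvd_natCast.2 (Dvd.intro_left _ rfl)
    have h4 : (p : ℤ) ∣ 2 ^ (p - 1) * ((r : ℕ) - (r' : ℕ) : ℤ) := by
      convert Int.dvd_trans hpm h3 using 1
      ring
    have hcop : IsCoprime (p : ℤ) (2 ^ (p - 1)) := by
      refine IsCoprime.pow_right ?_
      exact_mod_cast Nat.isCoprime_iff_coprime.2 ((Nat.coprime_primes hp Nat.prime_two).2 h2)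
    have h5 := hcop.dvd_of_dvd_mul_left h4
    have h6 : ((r : ℕ) - (r' : ℕ) : ℤ) = 0 :=
      Int.eq_zero_of_abs_lt_dvd h5 (by rw [abs_lt]; omega)
    exact Fin.ext (by omega)
  obtain ⟨r, hr⟩ := Finite.injective_iff_surjective.1 hg ⟨f, hf⟩
  have hmr : m (i r) = 2 ^ f * p := by rw [hmi, hr]
  refine ⟨i r, hmr, ?_⟩
  have h1 : (2 : ℤ) ^ f ∣ x + 2 ^ (p - 1) * (r : ℕ) - a (i r) := by
    refine Dvd.dvd.trans ?_ (hi r)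
    rw [hmr]
    push_cast
    exact Dvd.intro _ rfl
  have h3 := Int.dvd_sub h1 ((pow_dvd_pow (2 : ℤ) (show f ≤ p - 1 by omega)).mul_right ((r : ℕ) : ℤ))
  convert h3 using 1
  ring

theorem range_moduli_eq (hp : p.Prime) (h2 : p ≠ 2)
    (hm : Function.Injective m) (h1 : ∀ i, 1 < m i) (hd : ∀ i, m i ∣ 2 ^ (p - 1) * p)
    (hc : ∀ x : ℤ, ∃ i, (m i : ℤ) ∣ x - a i) :
    Set.range m = {d : ℕ | 2 ≤ d ∧ d ∣ 2 ^ (p - 1) * p} := by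
  let C : ℕ → ℤ → Prop := fun e z => ∃ i, m i = 2 ^ e ∧ (2 : ℤ) ^ e ∣ z - a i
  have hC : ∀ e x y, C e x → C e y → (2 : ℤ) ^ e ∣ x - y := by
    rintro e x y ⟨i, hi, hxi⟩ ⟨j, hj, hyj⟩
    obtain rfl : i = j := hm (hi.trans hj.symm)
    simpa using Int.dvd_sub hxi hyj
  have hmeets {x : ℤ} (hx : ∀ e, 0 < e → e ≤ p - 1 → ∀ z, (2 : ℤ) ^ (p - 1) ∣ z - x → ¬ C e z)
      {f : ℕ} (hf : f < p) : ∃ i, m i = 2 ^ f * p ∧ (2 : ℤ) ^ f ∣ x - a i := by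
    refine exists_modulus_two_pow_mul hp h2 hm hd hc (fun z hz i e he hie hzi => ?_) hf
    refine hx e (Nat.pos_of_ne_zero ?_) he z hz ⟨i, hie, hzi⟩
    rintro rfl
    have := h1 i
    simp [hie] at this
  refine Set.Subset.antisymm (Set.range_subset_iff.2 fun i => ⟨h1 i, hd i⟩) ?_
  rintro d ⟨hd2, hdn⟩
  obtain ⟨f, hf, rfl | rfl⟩ := dvd_two_pow_mul_prime hp hdn
  · by_contra hmiss
    have hCf (z : ℤ) : ¬ C f z := fun ⟨i, hi, _⟩ => hmiss ⟨i, hi⟩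
    obtain ⟨s, rfl⟩ : ∃ s, f = s + 1 :=
      Nat.exists_eq_succ_of_ne_zero (by rintro rfl; simp at hd2)
    obtain ⟨x, -, hx⟩ := exists_congr_avoiding hC 0 (Nat.zero_le s)
    have hext (w : ℤ) (hw : (2 : ℤ) ^ s ∣ w - x) : ∃ y, (2 : ℤ) ^ (s + 1) ∣ y - w ∧
        ∃ i, m i = 2 ^ (p - 1) * p ∧ (2 : ℤ) ^ (p - 1) ∣ y - a i := by
      obtain ⟨y, hyw, hy⟩ := exists_congr_avoiding hC w hf
      refine ⟨y, hyw, hmeets (fun e he hep z hz => ?_) (by have := hp.pos; omega)⟩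
      rcases lt_trichotomy e (s + 1) with hes | rfl | hes
      · refine hx e he (by omega) z ?_
        have h := Int.dvd_add (Int.dvd_add ((pow_dvd_pow (2 : ℤ) (by omega)).trans hz)
          ((pow_dvd_pow (2 : ℤ) s.le_succ).trans hyw)) hw
        convert h using 1
        ring
      · exact hCf z
      · exact hy e hes hep z hz
    obtain ⟨y, hy, i, hi, hyi⟩ := hext x (by simp)
    obtain ⟨y', hy', j, hj, hyj⟩ := hext (x + 2 ^ s) (by simp)
    obtain rfl : i = j := hm (hi.trans hj.symm)
    have h3 := (pow_dvd_pow (2 : ℤ) hf).trans (Int.dvd_sub hyj hyi)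
    have h4 : (2 : ℤ) ^ (s + 1) ∣ 2 ^ s := by
      convert Int.dvd_add (Int.dvd_sub h3 hy') hy using 1
      ring
    have := (pow_dvd_pow_iff (by norm_num) (by decide)).1 h4
    omega
  · obtain ⟨x, -, hx⟩ := exists_congr_avoiding hC 0 (Nat.zero_le (p - 1))
    obtain ⟨i, hi, -⟩ := hmeets hx (show f < p by have := hp.pos; omega)
    exact ⟨i, hi⟩

end Cover

theorem stmt12 :
    {n : ℕ | 0 < n ∧ IsCoveringNumber n ∧
      ∀ (k : ℕ) (a : Fin k → ℤ) (m : Fin k → ℕ),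
        Function.Injective m → (∀ i, 1 < m i) → (∀ i, m i ∣ n) →
        (∀ x : ℤ, ∃ i, (m i : ℤ) ∣ x - a i) →
        Set.range m = {d : ℕ | 2 ≤ d ∧ d ∣ n}}.Infinite := by
  refine Set.infinite_of_forall_exists_gt fun b => ?_
  obtain ⟨p, hbp, hp⟩ := Nat.exists_infinite_primes (b + 3)
  have h2 : p ≠ 2 := by omega
  have hle : p ≤ 2 ^ (p - 1) * p := Nat.le_mul_of_pos_left _ (by positivity)
  exact ⟨2 ^ (p - 1) * p, ⟨by omega, isCoveringNumber_two_pow_mul hp h2,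
    fun k a m hm h1 hd hc => range_moduli_eq hp h2 hm h1 hd hc⟩, by omega⟩
end
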